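/- arXiv:1904.03834 — 2 statements merged into one kernel-verified Lean document; each statement's English description precedes it below -/
import Mathlib

section
/- Let X_t be an order-p Markov chain on the finite state space 𝒳 = {1,…,m} whose transition tensor is parameterized by the mixture transition distribution (MTD) model p(X_t = i | X_{t−1} = j_1, …, X_{t−p} = j_p) = Σ_{ℓ=1}^p λ_ℓ Q^{(ℓ)}_{i j_ℓ}, where each Q^{(ℓ)} is column-stochastic with strictly positive diagonal entries, λ_ℓ > 0 for all ℓ and Σ_ℓ λ_ℓ = 1, and suppose the lifted multivariate transition matrix Q ∈ ℝ^{m^p × m^p} has distinct eigenvalues. Initialize (X_{−p},…,X_{−1}) at the unique stationary distribution ξ of Q, let g : 𝒳 → ℝ, and define Y_t = g(X_t). Then there exist C < ∞ and s ∈ (0,1) such that |γ_Y(k)| ≤ C s^k for all k ≥ 0; in particular Y_t has short memory. -/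
open Matrix Finset MeasureTheory Filter

/-- A column-stochastic matrix on an arbitrary finite index type. -/
def ColStochastic {n : Type*} [Fintype n] (P : Matrix n n ℝ) : Prop :=
  (∀ i j, 0 ≤ P i j) ∧ ∀ j, ∑ i, P i j = 1

/-- The lifted multivariate transition matrix of the MTD model (state at time `t` is
the tuple `s` with `s i = X (t - i)`). -/
noncomputable def liftedMTD {m p : ℕ} [NeZero p] (lam : Fin p → ℝ)
    (Q : Fin p → Matrix (Fin m) (Fin m) ℝ) :
    Matrix (Fin p → Fin m) (Fin p → Fin m) ℝ :=
  Matrix.of fun s s' =>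
    if ∀ i j : Fin p, (i : ℕ) = (j : ℕ) + 1 → s i = s' j then
      ∑ ℓ, lam ℓ * Q ℓ (s 0) (s' ℓ)
    else 0

/-- A matrix has distinct (complex) eigenvalues if its characteristic polynomial
over `ℂ` has no repeated roots. -/
def HasDistinctEigenvalues {n : Type*} [Fintype n] [DecidableEq n] (P : Matrix n n ℝ) : Prop :=
  ((P.map Complex.ofReal).charpoly.roots).Nodup


lemma aux_eig {V : Type*} [AddCommGroup V] [Module ℂ V] [FiniteDimensional ℂ V]
    (T : Module.End ℂ V) (h : T.charpoly.roots.Nodup) (ν : ℂ) (f : V)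
    (hf : f ∈ T.maxGenEigenspace ν) :
    (∀ v, v ≠ 0 → T v = ν • v → ∃ c : ℂ, f = c • v) ∧ T f = ν • f := by
  have h1 : ∀ v, v ≠ 0 → T v = ν • v → ∃ c : ℂ, f = c • v := by
    intro v hv hTv
    have hvm : v ∈ T.maxGenEigenspace ν := by
      have : v ∈ T.eigenspace ν := Module.End.mem_eigenspace_iff.2 hTv
      exact (T.genEigenspace ν).monotone le_top this
    have hle : Module.finrank ℂ (T.maxGenEigenspace ν) ≤ 1 := by
      classical
      rw [LinearMap.finrank_maxGenEigenspace_eq, ← Polynomial.count_roots]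
      exact Multiset.nodup_iff_count_le_one.1 h ν
    have hne : (⟨v, hvm⟩ : T.maxGenEigenspace ν) ≠ 0 := by
      intro h0; exact hv (congrArg Subtype.val h0)
    have hpos : 0 < Module.finrank ℂ (T.maxGenEigenspace ν) :=
      Module.finrank_pos_iff_exists_ne_zero.2 ⟨_, hne⟩
    obtain ⟨c, hc⟩ := (finrank_eq_one_iff_of_nonzero' _ hne).1 (le_antisymm hle hpos) ⟨f, hf⟩
    exact ⟨c, (congrArg Subtype.val hc).symm⟩
  refine ⟨h1, ?_⟩
  by_cases hf0 : f = 0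
  · simp [hf0]
  have hU : T.HasUnifEigenvalue ν ⊤ := by
    intro hb
    apply hf0
    have : f ∈ T.genEigenspace ν ⊤ := hf
    rw [hb] at this
    simpa using this
  have hE : T.HasEigenvalue ν :=
    (Module.End.hasUnifEigenvalue_iff_hasUnifEigenvalue_one ENat.top_pos).1 hU
  obtain ⟨w, hw⟩ := hE.exists_hasEigenvector
  obtain ⟨c, rfl⟩ := h1 w hw.2 hw.apply_eq_smul
  rw [map_smul, hw.apply_eq_smul, smul_comm]

lemma aux_decay {n : Type*} [Fintype n] [DecidableEq n] [Nonempty n] (P : Matrix n n ℝ)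
    (hP : ColStochastic P) (hd : HasDistinctEigenvalues P)
    (hH : ∀ (f : n → ℂ) (ν : ℂ), f ≠ 0 → (∀ x, ∑ y, (P y x : ℂ) * f y = ν * f x) →
      1 ≤ ‖ν‖ → ν = 1) (f : n → ℝ) :
    ∃ (c C s : ℝ), 0 ≤ C ∧ s ∈ Set.Ioo (0 : ℝ) 1 ∧
      ∀ (k : ℕ) x, |((Pᵀ ^ k) *ᵥ f) x - c| ≤ C * s ^ k := by
  set M : Matrix n n ℂ := P.map Complex.ofReal with hM
  set T : Module.End ℂ (n → ℂ) := Matrix.toLin' Mᵀ with hT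
  have hTa : ∀ f x, T f x = ∑ y, (P y x : ℂ) * f y := by
    intro f x
    simp [hT, hM, Matrix.mulVec, dotProduct]
  have hroots : T.charpoly.roots.Nodup := by
    rw [hT, Matrix.charpoly_toLin', Matrix.charpoly_transpose]
    exact hd
  have hone : T (fun _ => (1 : ℂ)) = (1 : ℂ) • (fun _ => (1 : ℂ)) := by
    ext x
    rw [hTa]
    have := hP.2 x
    simp only [mul_one, Pi.smul_apply, smul_eq_mul]
    exact_mod_cast this
  have key : ∀ f : n → ℂ, ∃ (c : ℂ) (C s : ℝ), 0 ≤ C ∧ s ∈ Set.Ioo (0 : ℝ) 1 ∧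
      ∀ (k : ℕ) x, ‖(T ^ k) f x - c‖ ≤ C * s ^ k := by
    intro f
    have hf : f ∈ ⨆ ν : ℂ, T.maxGenEigenspace ν := by
      rw [Module.End.iSup_maxGenEigenspace_eq_top]; trivial
    refine Submodule.iSup_induction _
      (motive := fun f : n → ℂ => ∃ (c : ℂ) (C s : ℝ), 0 ≤ C ∧ s ∈ Set.Ioo (0 : ℝ) 1 ∧
        ∀ (k : ℕ) x, ‖(T ^ k) f x - c‖ ≤ C * s ^ k) hf ?_ ?_ ?_
    · intro ν f hf
      obtain ⟨h1, h2⟩ := aux_eig T hroots ν f hf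
      have hpow : ∀ k : ℕ, (T ^ k) f = ν ^ k • f := by
        intro k
        induction k with
        | zero => simp
        | succ k ih => rw [pow_succ', Module.End.mul_apply, ih, map_smul, h2, smul_smul, pow_succ]
      by_cases hf0 : f = 0
      · refine ⟨0, 0, 1/2, le_rfl, by norm_num, ?_⟩
        intro k x; simp [hf0]
      by_cases hν : 1 ≤ ‖ν‖
      · have hν1 : ν = 1 := by
          refine hH f ν hf0 ?_ hν
          intro x
          rw [← hTa, h2]; simp
        subst hν1
        obtain ⟨c, hc⟩ := h1 (fun _ => 1) (by
          intro h0
          have := congrFun h0 (Classical.arbitrary n)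
          simp at this) hone
        refine ⟨c, 0, 1/2, le_rfl, by norm_num, ?_⟩
        intro k x
        rw [hpow]
        simp [hc]
      · push Not at hν
        refine ⟨0, ‖f‖, max ‖ν‖ (1/2), norm_nonneg _, ⟨by positivity, by
          apply max_lt hν; norm_num⟩, ?_⟩
        intro k x
        rw [hpow]
        simp only [Pi.smul_apply, smul_eq_mul, sub_zero, norm_mul, norm_pow]
        rw [mul_comm]
        gcongr
        · exact norm_le_pi_norm f x
        · exact le_max_left _ _
    · exact ⟨0, 0, 1/2, le_rfl, by norm_num, by intro k x; simp⟩
    · rintro f g ⟨c, C, s, hC, hs, h⟩ ⟨c', C', s', hC', hs', h'⟩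
      refine ⟨c + c', C + C', max s s', by positivity,
        ⟨lt_max_of_lt_left hs.1, max_lt hs.2 hs'.2⟩, ?_⟩
      intro k x
      have e : (T ^ k) (f + g) x - (c + c') = ((T ^ k) f x - c) + ((T ^ k) g x - c') := by
        rw [map_add, Pi.add_apply]; ring
      rw [e, add_mul]
      refine (norm_add_le _ _).trans (add_le_add ((h k x).trans ?_) ((h' k x).trans ?_))
      · have := hs.1.le
        gcongr
        exact le_max_left _ _
      · have := hs'.1.le
        gcongr
        exact le_max_right _ _
  obtain ⟨c, C, s, hC, hs, h⟩ := key (fun x => (f x : ℂ))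
  refine ⟨c.re, C, s, hC, hs, ?_⟩
  have hk : ∀ k : ℕ, (T ^ k) (fun x => (f x : ℂ)) = fun x => ((((Pᵀ ^ k) *ᵥ f) x : ℝ) : ℂ) := by
    intro k
    induction k with
    | zero => simp
    | succ k ih =>
      rw [pow_succ', Module.End.mul_apply, ih]
      ext x
      rw [hTa, pow_succ', ← Matrix.mulVec_mulVec]
      simp [Matrix.mulVec, dotProduct]
  intro k x
  have := h k x
  rw [hk] at this
  refine le_trans ?_ this
  have h3 := Complex.abs_re_le_norm (((((Pᵀ ^ k) *ᵥ f) x : ℝ) : ℂ) - c)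
  simpa using h3

def mtdShift {m p : ℕ} [NeZero p] (i : Fin m) (s : Fin p → Fin m) : Fin p → Fin m :=
  fun j => if (j : ℕ) = 0 then i else s ⟨(j : ℕ) - 1, by omega⟩

lemma mtdShift_zero {m p : ℕ} [NeZero p] (i : Fin m) (s : Fin p → Fin m) :
    mtdShift i s 0 = i := by simp [mtdShift]

lemma mtdShift_compat {m p : ℕ} [NeZero p] (s s' : Fin p → Fin m) :
    (∀ i j : Fin p, (i : ℕ) = (j : ℕ) + 1 → s i = s' j) ↔ s = mtdShift (s 0) s' := by
  constructor
  · intro h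
    ext1 j
    unfold mtdShift
    split_ifs with hj
    · congr 1
      exact Fin.ext (by simpa using hj)
    · apply h; simp; omega
  · intro h i j hij
    rw [h]
    unfold mtdShift
    rw [if_neg (by omega)]
    congr 1
    exact Fin.ext (by simp; omega)

lemma lifted_sum {m p : ℕ} [NeZero p] (lam : Fin p → ℝ)
    (Q : Fin p → Matrix (Fin m) (Fin m) ℝ) (h : (Fin p → Fin m) → ℝ) (x : Fin p → Fin m) :
    ∑ y, liftedMTD lam Q y x * h y =
      ∑ i, (∑ ℓ, lam ℓ * Q ℓ i (x ℓ)) * h (mtdShift i x) := by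
  have : ∀ y, liftedMTD lam Q y x * h y =
      ∑ i, if y = mtdShift i x then (∑ ℓ, lam ℓ * Q ℓ i (x ℓ)) * h (mtdShift i x) else 0 := by
    intro y
    rw [Finset.sum_eq_single (y 0)]
    · simp only [liftedMTD, Matrix.of_apply, mtdShift_compat]
      split_ifs with hy
      · rw [← hy]
      · simp
    · intro i _ hi
      rw [if_neg]
      intro hy
      apply hi
      rw [hy, mtdShift_zero]
    · simp
  simp_rw [this]
  rw [Finset.sum_comm]
  simp

lemma lifted_stoch {m p : ℕ} [NeZero p] (lam : Fin p → ℝ) (Q : Fin p → Matrix (Fin m) (Fin m) ℝ)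
    (hQstoch : ∀ ℓ, ColStochastic (Q ℓ)) (hlam_pos : ∀ ℓ, 0 < lam ℓ)
    (hlam_sum : ∑ ℓ, lam ℓ = 1) : ColStochastic (liftedMTD lam Q) := by
  constructor
  · intro y x
    simp only [liftedMTD, Matrix.of_apply]
    split_ifs
    · exact Finset.sum_nonneg fun ℓ _ => mul_nonneg (hlam_pos ℓ).le ((hQstoch ℓ).1 _ _)
    · exact le_rfl
  · intro x
    have := lifted_sum lam Q (fun _ => 1) x
    simp only [mul_one] at this
    rw [this, Finset.sum_comm]
    simp_rw [← Finset.mul_sum, (hQstoch _).2, mul_one]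
    exact hlam_sum

lemma lifted_pos {m p : ℕ} [NeZero p] (lam : Fin p → ℝ) (Q : Fin p → Matrix (Fin m) (Fin m) ℝ)
    (hQstoch : ∀ ℓ, ColStochastic (Q ℓ)) (hQdiag : ∀ ℓ i, 0 < Q ℓ i i)
    (hlam_pos : ∀ ℓ, 0 < lam ℓ) (x : Fin p → Fin m) :
    0 < liftedMTD lam Q (mtdShift (x 0) x) x := by
  simp only [liftedMTD, Matrix.of_apply, mtdShift_compat, mtdShift_zero, if_true]
  exact Finset.sum_pos' (fun ℓ _ => mul_nonneg (hlam_pos ℓ).le ((hQstoch ℓ).1 _ _))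
    ⟨0, Finset.mem_univ _, mul_pos (hlam_pos 0) (hQdiag 0 _)⟩

lemma aux_rigid {n : Type*} [Fintype n] (P : Matrix n n ℝ)
    (hP : ColStochastic P) (f : n → ℂ) (R : ℝ) (hR : ∀ x, ‖f x‖ ≤ R) (x : n) (a : ℂ)
    (ha : R ≤ ‖a‖) (hs : ∑ y, (P y x : ℂ) * f y = a) (y : n) (hy : 0 < P y x) : f y = a := by
  have hle : ‖a‖ ≤ R := by
    rw [← hs]
    refine (norm_sum_le _ _).trans ?_
    calc ∑ y, ‖(P y x : ℂ) * f y‖ ≤ ∑ y, P y x * R := by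
          apply Finset.sum_le_sum
          intro y _
          rw [norm_mul, Complex.norm_real, Real.norm_of_nonneg (hP.1 y x)]
          exact mul_le_mul_of_nonneg_left (hR y) (hP.1 y x)
      _ = R := by rw [← Finset.sum_mul, hP.2, one_mul]
  have haR : ‖a‖ = R := le_antisymm hle ha
  -- squared distances
  have hsq : ∀ z, ‖f z - a‖ ^ 2 ≤ 2 * (R ^ 2 - (f z * star a).re) := by
    intro z
    have h1 : ‖f z - a‖ ^ 2 = ‖f z‖ ^ 2 + ‖a‖ ^ 2 - 2 * (f z * star a).re := by
      simp only [Complex.sq_norm, Complex.normSq_apply, Complex.star_def, Complex.mul_re, Complex.conj_re,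
        Complex.conj_im, Complex.sub_re, Complex.sub_im]
      ring
    rw [h1, haR]
    have := pow_le_pow_left₀ (norm_nonneg _) (hR z) 2
    linarith
  have hsum : ∑ z, P z x * (f z * star a).re = R ^ 2 := by
    have h2 : (∑ z, (P z x : ℂ) * f z) * star a = a * star a := by rw [hs]
    have h3 := congrArg Complex.re h2
    rw [Finset.sum_mul, Complex.re_sum] at h3
    have h4 : (a * star a).re = R ^ 2 := by
      rw [← haR, Complex.sq_norm, Complex.normSq_apply]
      simp
    rw [h4] at h3
    rw [← h3]
    refine Finset.sum_congr rfl fun z _ => ?_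
    rw [mul_assoc, Complex.re_ofReal_mul]
  have h0 : ∑ z, P z x * ‖f z - a‖ ^ 2 ≤ 0 := by
    calc ∑ z, P z x * ‖f z - a‖ ^ 2 ≤ ∑ z, P z x * (2 * (R ^ 2 - (f z * star a).re)) := by
          exact Finset.sum_le_sum fun z _ => mul_le_mul_of_nonneg_left (hsq z) (hP.1 z x)
      _ = 2 * ((∑ z, P z x) * R ^ 2 - ∑ z, P z x * (f z * star a).re) := by
          rw [Finset.sum_mul, ← Finset.sum_sub_distrib, Finset.mul_sum]
          refine Finset.sum_congr rfl fun z _ => ?_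
          ring
      _ = 0 := by rw [hP.2, hsum]; ring
  have h5 : P y x * ‖f y - a‖ ^ 2 ≤ 0 :=
    (Finset.single_le_sum (f := fun z => P z x * ‖f z - a‖ ^ 2)
      (fun z _ => mul_nonneg (hP.1 z x) (sq_nonneg _)) (Finset.mem_univ y)).trans h0
  have h6 : ‖f y - a‖ ^ 2 ≤ 0 := by
    by_contra hc
    push Not at hc
    have := mul_pos hy hc
    linarith
  have h7 : ‖f y - a‖ = 0 := by
    have := sq_nonneg ‖f y - a‖
    exact pow_eq_zero_iff (two_ne_zero) |>.1 (le_antisymm h6 this)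
  exact sub_eq_zero.1 (norm_eq_zero.1 h7)

lemma lifted_periph {m p : ℕ} [NeZero p] (lam : Fin p → ℝ) (Q : Fin p → Matrix (Fin m) (Fin m) ℝ)
    (hQstoch : ∀ ℓ, ColStochastic (Q ℓ)) (hQdiag : ∀ ℓ i, 0 < Q ℓ i i)
    (hlam_pos : ∀ ℓ, 0 < lam ℓ) (hlam_sum : ∑ ℓ, lam ℓ = 1)
    (f : (Fin p → Fin m) → ℂ) (ν : ℂ) (hf : f ≠ 0)
    (hev : ∀ x, ∑ y, (liftedMTD lam Q y x : ℂ) * f y = ν * f x) (hν : 1 ≤ ‖ν‖) : ν = 1 := by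
  have hP := lifted_stoch lam Q hQstoch hlam_pos hlam_sum
  obtain ⟨x0, hx0⟩ := Function.ne_iff.1 hf
  haveI : Nonempty (Fin p → Fin m) := ⟨x0⟩
  obtain ⟨x, hx⟩ := Finite.exists_max (fun x => ‖f x‖)
  have hpos : 0 < ‖f x‖ := lt_of_lt_of_le (norm_pos_iff.2 hx0) (hx x0)
  have hstep : ∀ z, ‖f z‖ = ‖f x‖ → f (mtdShift (z 0) z) = ν * f z := by
    intro z hz
    refine aux_rigid _ hP f ‖f x‖ hx z _ ?_ (hev z) _ (lifted_pos lam Q hQstoch hQdiag hlam_pos z)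
    rw [norm_mul, hz]
    exact le_mul_of_one_le_left hpos.le hν
  have hstepn : ∀ z, ‖f z‖ = ‖f x‖ → ‖f (mtdShift (z 0) z)‖ = ‖f x‖ := by
    intro z hz
    refine le_antisymm (hx _) ?_
    rw [hstep z hz, norm_mul, hz]
    exact le_mul_of_one_le_left hpos.le hν
  have hiter : ∀ k : ℕ, ∃ z : Fin p → Fin m, ‖f z‖ = ‖f x‖ ∧
      ∀ j : Fin p, (j : ℕ) ≤ k → z j = x 0 := by
    intro k
    induction k with
    | zero =>
      refine ⟨x, rfl, fun j hj => ?_⟩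
      congr 1
      exact Fin.ext (by simpa using hj)
    | succ k ih =>
      obtain ⟨z, hz, hzj⟩ := ih
      refine ⟨mtdShift (z 0) z, hstepn z hz, fun j hj => ?_⟩
      unfold mtdShift
      split_ifs with h
      · exact hzj 0 (by simp)
      · exact hzj _ (by simp; omega)
  obtain ⟨z, hz, hzj⟩ := hiter p
  have hfix : mtdShift (z 0) z = z := by
    ext1 j
    unfold mtdShift
    split_ifs with h
    · rw [hzj 0 (by simp), hzj j j.2.le]
    · rw [hzj _ (by simp; omega), hzj j j.2.le]
  have h1 := hstep z hz
  rw [hfix] at h1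
  have hz0 : f z ≠ 0 := norm_pos_iff.1 (hz ▸ hpos)
  have h2 : (ν - 1) * f z = 0 := by rw [sub_mul, one_mul, ← h1, sub_self]
  rcases mul_eq_zero.1 h2 with h | h
  · exact sub_eq_zero.1 h
  · exact absurd h hz0

lemma int_path {m : ℕ} {Ω : Type*} [MeasurableSpace Ω] (μ : Measure Ω) [IsProbabilityMeasure μ]
    (X : ℕ → Ω → Fin m) (hXmeas : ∀ t, Measurable (X t)) (n : ℕ) (F : (Fin n → Fin m) → ℝ) :
    ∫ ω, F (fun i => X i ω) ∂μ = ∑ w, (μ {ω | ∀ s : Fin n, X s ω = w s}).toReal * F w := by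
  have hm : Measurable (fun ω => fun i : Fin n => X i ω) := measurable_pi_lambda _ fun i => hXmeas i
  haveI : IsProbabilityMeasure (μ.map (fun ω => fun i : Fin n => X i ω)) :=
    Measure.isProbabilityMeasure_map hm.aemeasurable
  have h1 : ∫ ω, F (fun i => X i ω) ∂μ = ∫ w, F w ∂(μ.map (fun ω => fun i : Fin n => X i ω)) := by
    rw [integral_map hm.aemeasurable]
    exact (measurable_of_finite F).aestronglyMeasurable
  rw [h1, integral_fintype .of_finite]
  refine Finset.sum_congr rfl fun w _ => ?_
  rw [measureReal_def, Measure.map_apply hm (measurableSet_singleton w), smul_eq_mul]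
  congr 3
  ext ω
  simp [funext_iff]

lemma one_step {m p : ℕ} [NeZero p] (lam : Fin p → ℝ) (Q : Fin p → Matrix (Fin m) (Fin m) ℝ)
    {Ω : Type*} [MeasurableSpace Ω] (μ : Measure Ω) [IsProbabilityMeasure μ]
    (X : ℕ → Ω → Fin m) (hXmeas : ∀ t, Measurable (X t))
    (hMarkov : ∀ (t : ℕ) (hist : ℕ → Fin m),
      (μ {ω | ∀ s ≤ t + p, X s ω = hist s}).toReal
        = (∑ ℓ : Fin p, lam ℓ * Q ℓ (hist (t + p)) (hist (t + p - 1 - (ℓ : ℕ))))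
            * (μ {ω | ∀ s < t + p, X s ω = hist s}).toReal)
    (t : ℕ) (F : (Fin (t + p) → Fin m) → Fin m → ℝ) :
    ∫ ω, F (fun i => X i ω) (X (t + p) ω) ∂μ =
      ∫ ω, ∑ i, (∑ ℓ : Fin p, lam ℓ * Q ℓ i (X (t + p - 1 - (ℓ : ℕ)) ω)) *
        F (fun i => X i ω) i ∂μ := by
  have hp : 0 < p := Nat.pos_of_ne_zero (NeZero.ne p)
  have e1 := int_path μ X hXmeas (t + p + 1)
    (fun w => F (fun i => w i.castSucc) (w (Fin.last _)))
  have e2 := int_path μ X hXmeas (t + p)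
    (fun w => ∑ i, (∑ ℓ : Fin p, lam ℓ * Q ℓ i (w ⟨t + p - 1 - (ℓ : ℕ), by omega⟩)) * F w i)
  simp only [Fin.val_castSucc, Fin.val_last] at e1
  rw [e1]
  refine Eq.trans ?_ e2.symm
  rw [← (Fin.snocEquiv (fun _ : Fin (t + p + 1) => Fin m)).sum_comp, Fintype.sum_prod_type,
    Finset.sum_comm]
  refine Finset.sum_congr rfl fun w _ => ?_
  rw [Finset.mul_sum]
  refine Finset.sum_congr rfl fun i _ => ?_
  simp only [Fin.snocEquiv_apply, Fin.snoc_castSucc, Fin.snoc_last]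
  have hM := hMarkov t (fun s => if h : s < t + p then w ⟨s, h⟩ else i)
  have s1 : {ω | ∀ s ≤ t + p, X s ω = if h : s < t + p then w ⟨s, h⟩ else i} =
      {ω | ∀ s : Fin (t + p + 1), X s ω = Fin.snoc (α := fun _ => Fin m) w i s} := by
    ext ω
    simp only [Set.mem_setOf_eq]
    constructor
    · intro h s
      rw [h s (by omega)]
      rfl
    · intro h s hs
      rw [h ⟨s, by omega⟩]
      rfl
  have s2 : {ω | ∀ s < t + p, X s ω = if h : s < t + p then w ⟨s, h⟩ else i} =
      {ω | ∀ s : Fin (t + p), X s ω = w s} := by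
    ext ω
    simp only [Set.mem_setOf_eq]
    constructor
    · intro h s
      rw [h s s.2, dif_pos s.2]
    · intro h s hs
      rw [dif_pos hs, h ⟨s, hs⟩]
  rw [s1, s2] at hM
  rw [hM]
  have s3 : ∀ ℓ : Fin p, t + p - 1 - (ℓ : ℕ) < t + p := fun ℓ => by omega
  simp only [lt_irrefl, dif_neg, not_false_eq_true, s3, dif_pos]
  ring

lemma multi_step {m p : ℕ} [NeZero p] (lam : Fin p → ℝ) (Q : Fin p → Matrix (Fin m) (Fin m) ℝ)
    {Ω : Type*} [MeasurableSpace Ω] (μ : Measure Ω) [IsProbabilityMeasure μ]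
    (X : ℕ → Ω → Fin m) (hXmeas : ∀ t, Measurable (X t))
    (hMarkov : ∀ (t : ℕ) (hist : ℕ → Fin m),
      (μ {ω | ∀ s ≤ t + p, X s ω = hist s}).toReal
        = (∑ ℓ : Fin p, lam ℓ * Q ℓ (hist (t + p)) (hist (t + p - 1 - (ℓ : ℕ))))
            * (μ {ω | ∀ s < t + p, X s ω = hist s}).toReal)
    (G : Fin m → ℝ) (k : ℕ) (h : (Fin p → Fin m) → ℝ) :
    ∫ ω, G (X p ω) * h (fun ℓ => X (1 + k + p - 1 - (ℓ : ℕ)) ω) ∂μ =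
      ∫ ω, G (X p ω) * ((liftedMTD lam Q)ᵀ ^ k *ᵥ h) (fun ℓ => X (1 + p - 1 - (ℓ : ℕ)) ω) ∂μ := by
  have hp : 0 < p := Nat.pos_of_ne_zero (NeZero.ne p)
  induction k generalizing h with
  | zero => simp
  | succ k ih =>
    rw [pow_succ, ← Matrix.mulVec_mulVec, ← ih]
    have e := one_step lam Q μ X hXmeas hMarkov (1 + k) (fun w i => G (w ⟨p, by omega⟩) *
      h (mtdShift i (fun ℓ : Fin p => w ⟨1 + k + p - 1 - (ℓ : ℕ), by omega⟩)))
    simp only at e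
    refine Eq.trans ?_ (e.trans ?_)
    · congr 1
      ext ω
      congr 2
      ext1 ℓ
      unfold mtdShift
      split_ifs with hl
      · congr 1; omega
      · congr 1
        simp only
        omega
    · congr 1
      ext ω
      have := lifted_sum lam Q h (fun ℓ => X (1 + k + p - 1 - (ℓ : ℕ)) ω)
      simp only [Matrix.mulVec, dotProduct, Matrix.transpose_apply]
      rw [this, Finset.mul_sum]
      refine Finset.sum_congr rfl fun i _ => ?_
      ring

/-- Let `X` be an order-`p` Markov chain on `Fin m` whose transition
tensor is given by the MTD model with column-stochastic matrices `Q ℓ` having strictly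
positive diagonals, weights `lam ℓ > 0` summing to one, and whose lifted transition
matrix has distinct eigenvalues.  The chain is initialized (on the time indices
`0, …, p-1`, which play the role of times `-p, …, -1`) at the unique stationary
distribution `ξ` of the lifted matrix.  Then for any `g : Fin m → ℝ`, the process
`Y t = g (X (t + p))` has autocovariance bounded by `C * s ^ k` for some `C < ∞` and
`s ∈ (0,1)`; in particular `Y` has short memory. -/
theorem mtd_function_short_memory
    {m p : ℕ} [NeZero p] (lam : Fin p → ℝ) (Q : Fin p → Matrix (Fin m) (Fin m) ℝ)
    (hQstoch : ∀ ℓ, ColStochastic (Q ℓ))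
    (hQdiag : ∀ ℓ i, 0 < Q ℓ i i)
    (hlam_pos : ∀ ℓ, 0 < lam ℓ)
    (hlam_sum : ∑ ℓ, lam ℓ = 1)
    (heig : HasDistinctEigenvalues (liftedMTD lam Q))
    -- `ξ` is the (unique) stationary distribution of the lifted transition matrix
    (ξ : (Fin p → Fin m) → ℝ)
    (hξ_nonneg : ∀ s, 0 ≤ ξ s) (hξ_sum : ∑ s, ξ s = 1)
    (hξ_stat : (liftedMTD lam Q).mulVec ξ = ξ)
    {Ω : Type*} [MeasurableSpace Ω] (μ : Measure Ω) [IsProbabilityMeasure μ]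
    (X : ℕ → Ω → Fin m) (hXmeas : ∀ t, Measurable (X t))
    -- the initial block `(X (p-1), …, X 0)` is distributed according to `ξ`
    (hinit : ∀ v : Fin p → Fin m,
      (μ {ω | ∀ i : Fin p, X (p - 1 - (i : ℕ)) ω = v i}).toReal = ξ v)
    -- order-`p` Markov property with the MTD transition probabilities
    (hMarkov : ∀ (t : ℕ) (hist : ℕ → Fin m),
      (μ {ω | ∀ s ≤ t + p, X s ω = hist s}).toReal
        = (∑ ℓ : Fin p, lam ℓ * Q ℓ (hist (t + p)) (hist (t + p - 1 - (ℓ : ℕ))))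
            * (μ {ω | ∀ s < t + p, X s ω = hist s}).toReal)
    (g : Fin m → ℝ)
    -- the autocovariance sequence of `Y t = g (X t)` (in the original time indexing,
    -- i.e. `Y t = g (X (t + p))` here), independent of `t` by stationarity
    (γ : ℕ → ℝ)
    (hγ : ∀ (t k : ℕ), γ k =
      (∫ ω, g (X (t + p) ω) * g (X (t + p + k) ω) ∂μ)
        - (∫ ω, g (X (t + p) ω) ∂μ) * (∫ ω, g (X (t + p + k) ω) ∂μ)) :
    ∃ (C : ℝ) (s : ℝ), s ∈ Set.Ioo (0 : ℝ) 1 ∧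
      (∀ k : ℕ, |γ k| ≤ C * s ^ k) ∧ Summable (fun k : ℕ => |γ k|) := by
  have hp : 0 < p := Nat.pos_of_ne_zero (NeZero.ne p)
  haveI : Nonempty (Fin p → Fin m) := by
    by_contra hne
    rw [not_nonempty_iff] at hne
    simp at hξ_sum
  set h : (Fin p → Fin m) → ℝ := fun s => g (s 0) with hh
  obtain ⟨c, C, s, hC, hs, hdec⟩ := aux_decay (liftedMTD lam Q)
    (lifted_stoch lam Q hQstoch hlam_pos hlam_sum) heig
    (fun f ν => lifted_periph lam Q hQstoch hQdiag hlam_pos hlam_sum f ν) h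
  have hbound : ∀ k : ℕ, |γ k| ≤ (2 * ‖g‖ * C) * s ^ k := by
    intro k
    set A : Ω → ℝ := fun ω =>
      ((liftedMTD lam Q)ᵀ ^ k *ᵥ h) (fun ℓ => X (1 + p - 1 - (ℓ : ℕ)) ω) with hA
    have e1 := multi_step lam Q μ X hXmeas hMarkov g k h
    have e2 := multi_step lam Q μ X hXmeas hMarkov (fun _ => 1) k h
    simp only [one_mul] at e2
    have hidx : ∀ ω, h (fun ℓ => X (1 + k + p - 1 - (ℓ : ℕ)) ω) = g (X (p + k) ω) := by
      intro ω
      simp only [hh]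
      congr 2
      simp
      omega
    simp only [hidx] at e1 e2
    rw [hγ 0 k]
    simp only [zero_add]
    rw [e1, e2]
    change |(∫ ω, g (X p ω) * A ω ∂μ) - (∫ ω, g (X p ω) ∂μ) * ∫ ω, A ω ∂μ| ≤ _
    have hgm : Measurable (fun ω => g (X p ω)) := (measurable_of_finite g).comp (hXmeas p)
    have hAm : Measurable A := 
      (measurable_of_finite ((liftedMTD lam Q)ᵀ ^ k *ᵥ h)).comp
      (measurable_pi_lambda (fun ω => fun ℓ : Fin p => X (1 + p - 1 - (ℓ : ℕ)) ω)
        fun ℓ => hXmeas _)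
    have hgb : ∀ ω, ‖g (X p ω)‖ ≤ ‖g‖ := fun ω => norm_le_pi_norm g _
    have hAb : ∀ ω, ‖A ω - c‖ ≤ C * s ^ k := fun ω => hdec k _
    have hgi : Integrable (fun ω => g (X p ω)) μ :=
      Integrable.of_bound hgm.aestronglyMeasurable ‖g‖ (Eventually.of_forall hgb)
    have hAci : Integrable (fun ω => A ω - c) μ :=
      Integrable.of_bound (hAm.sub_const c).aestronglyMeasurable _ (Eventually.of_forall hAb)
    have hb0 : 0 ≤ C * s ^ k := mul_nonneg hC (pow_nonneg hs.1.le k)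
    have hprod : ∀ ω, ‖g (X p ω) * (A ω - c)‖ ≤ ‖g‖ * (C * s ^ k) := fun ω => by
      rw [norm_mul]
      exact mul_le_mul (hgb ω) (hAb ω) (norm_nonneg _) (norm_nonneg _)
    have hpi : Integrable (fun ω => g (X p ω) * (A ω - c)) μ :=
      Integrable.of_bound (hgm.mul (hAm.sub_const c)).aestronglyMeasurable _
        (Eventually.of_forall hprod)
    have i1 : ∫ ω, g (X p ω) * A ω ∂μ =
        (∫ ω, g (X p ω) * (A ω - c) ∂μ) + (∫ ω, g (X p ω) ∂μ) * c := by
      rw [← integral_mul_const, ← integral_add hpi (hgi.mul_const c)]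
      congr 1; ext ω; ring
    have i2 : ∫ ω, A ω ∂μ = (∫ ω, (A ω - c) ∂μ) + c := by
      have : ∫ ω, A ω ∂μ = ∫ ω, ((A ω - c) + c) ∂μ := by simp
      rw [this, integral_add hAci (integrable_const c)]
      simp
    have b1 : ‖∫ ω, g (X p ω) * (A ω - c) ∂μ‖ ≤ ‖g‖ * (C * s ^ k) := by
      simpa using norm_integral_le_of_norm_le_const (μ := μ) (Eventually.of_forall hprod)
    have b2 : ‖∫ ω, g (X p ω) ∂μ‖ ≤ ‖g‖ := by
      simpa using norm_integral_le_of_norm_le_const (μ := μ) (Eventually.of_forall hgb)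
    have b3 : ‖∫ ω, (A ω - c) ∂μ‖ ≤ C * s ^ k := by
      simpa using norm_integral_le_of_norm_le_const (μ := μ) (Eventually.of_forall hAb)
    have b4 : ‖(∫ ω, g (X p ω) ∂μ) * ∫ ω, (A ω - c) ∂μ‖ ≤ ‖g‖ * (C * s ^ k) := by
      rw [norm_mul]
      exact mul_le_mul b2 b3 (norm_nonneg _) (norm_nonneg _)
    have e3 : (∫ ω, g (X p ω) * A ω ∂μ) - (∫ ω, g (X p ω) ∂μ) * ∫ ω, A ω ∂μ =
        (∫ ω, g (X p ω) * (A ω - c) ∂μ) - (∫ ω, g (X p ω) ∂μ) * ∫ ω, (A ω - c) ∂μ := by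
      rw [i1, i2]; ring
    rw [e3, ← Real.norm_eq_abs]
    refine (norm_sub_le _ _).trans ?_
    linarith
  refine ⟨2 * ‖g‖ * C, s, hs, hbound, ?_⟩
  exact Summable.of_nonneg_of_le (fun k => abs_nonneg _) hbound
    ((summable_geometric_of_lt_one hs.1.le hs.2).mul_left _)
end

section
/- Let X_{t+1} = f(X_t) + ε_t be the scalar nonlinear autoregressive process where {ε_t} is an i.i.d. sequence with E|ε_t| < ∞ whose law has a strictly positive density with respect to Lebesgue measure, and f : ℝ → ℝ is measurable, bounded on compact sets, and satisfies sup_{|x| > r} |f(x)/x| < 1 for some r > 0; initialize X_0 at the unique stationary distribution π. If in addition E|X_t|^{2+δ} < ∞ for some δ > 0, then the stationary process {X_t} has exponentially decaying autocovariance: there exist C < ∞ and s ∈ (0,1) such that |γ_X(k)| = |Cov(X_0, X_k)| ≤ C s^k for all k ≥ 0; in particular {X_t} is a short memory process. -/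
open MeasureTheory

/-- The one-step transition operator on measures of the autoregression
`X (t+1) = f (X t) + ε t`, where the noise `ε t` has law `μ`. -/
noncomputable def arStep (μ : Measure ℝ) (f : ℝ → ℝ) (ν : Measure ℝ) : Measure ℝ :=
  ν.bind fun x => μ.map fun y => f x + y

lemma nar_cont (ρ : ℝ → ℝ) (hint : Integrable ρ) :
    Continuous fun z : ℝ => ∫ u, |ρ u - ρ (u - z)| := by
  have hm : MemLp ρ 1 volume := memLp_one_iff_integrable.2 hint
  have : Fact ((1 : ENNReal) ≠ ⊤) := ⟨by simp⟩
  have hc : Continuous fun z : ℝ => ‖hm.toLp ρ - (DomAddAct.mk (-z) +ᵥ hm.toLp ρ)‖ := by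
    have h1 : Continuous fun z : ℝ => DomAddAct.mk (-z) := by fun_prop
    have h2 : Continuous fun z : ℝ => (DomAddAct.mk (-z) +ᵥ hm.toLp ρ) :=
      h1.vadd continuous_const
    exact (continuous_const.sub h2).norm
  refine hc.congr fun z => ?_
  rw [DomAddAct.mk_vadd_toLp, ← MemLp.toLp_sub, Lp.norm_toLp, eLpNorm_one_eq_lintegral_enorm,
    ← integral_norm_eq_lintegral_enorm]
  · refine integral_congr_ae (Filter.Eventually.of_forall fun u => ?_)
    simp [sub_eq_add_neg, add_comm]
  · have := hint.comp_add_left (-z)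
    exact (hint.sub this).aestronglyMeasurable

lemma nar_tv (ρ : ℝ → ℝ) (hpos : ∀ x, 0 < ρ x) (hint : Integrable ρ)
    (h1 : ∫ x, ρ x = 1) (B : ℝ) :
    ∃ α : ℝ, 0 < α ∧ ∀ z, |z| ≤ B → ∫ u, |ρ u - ρ (u - z)| ≤ 2 - 2 * α := by
  have hlt : ∀ z, ∫ u, |ρ u - ρ (u - z)| < 2 := by
    intro z
    have hz : Integrable fun u => ρ (u - z) := hint.comp_sub_right z
    have hd : Integrable fun u => |ρ u - ρ (u - z)| := (hint.sub hz).abs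
    have hp : ∀ u, 0 < (ρ u + ρ (u - z)) - |ρ u - ρ (u - z)| := by
      intro u
      have := hpos u; have := hpos (u - z)
      rcases abs_cases (ρ u - ρ (u - z)) with h | h <;> linarith
    have key : 0 < ∫ u, ((ρ u + ρ (u - z)) - |ρ u - ρ (u - z)|) := by
      rw [integral_pos_iff_support_of_nonneg (fun u => (hp u).le) ((hint.add hz).sub hd)]
      have : Function.support (fun u => (ρ u + ρ (u - z)) - |ρ u - ρ (u - z)|) = Set.univ := by
        ext u; simpa using (hp u).ne'
      rw [this]; simp
    have e1 : ∫ u, ((ρ u + ρ (u - z)) - |ρ u - ρ (u - z)|)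
      = (∫ u, (ρ u + ρ (u - z))) - ∫ u, |ρ u - ρ (u - z)| := integral_sub (hint.add hz) hd
    have e2 : ∫ u, (ρ u + ρ (u - z)) = (∫ u, ρ u) + ∫ u, ρ (u - z) := integral_add hint hz
    have e3 : ∫ u, ρ (u - z) = 1 := by rw [integral_sub_right_eq_self ρ z, h1]
    linarith
  by_cases hB : 0 ≤ B
  · obtain ⟨z₀, -, hz₀⟩ := (isCompact_Icc (a := -B) (b := B)).exists_isMaxOn
      ⟨0, by simpa using hB⟩ (nar_cont ρ hint).continuousOn
    refine ⟨(2 - ∫ u, |ρ u - ρ (u - z₀)|) / 2, by linarith [hlt z₀], fun z hz => ?_⟩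
    have := hz₀ (abs_le.1 hz)
    simp only [Set.mem_ofPred_eq] at this
    linarith
  · exact ⟨1, one_pos, fun z hz => absurd ((abs_nonneg z).trans hz) hB⟩

lemma nar_step_eq (μ : Measure ℝ) [IsProbabilityMeasure μ] (f : ℝ → ℝ) (hf : Measurable f)
    (ν : Measure ℝ) [IsProbabilityMeasure ν] :
    arStep μ f ν = (ν.prod μ).map fun p => f p.1 + p.2 := by
  have hm : Measurable fun p : ℝ × ℝ => f p.1 + p.2 := by fun_prop
  have hk : Measurable fun x => μ.map fun y => f x + y := by
    refine Measure.measurable_of_measurable_coe _ fun s hs => ?_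
    have : ∀ x, (μ.map fun y => f x + y) s =
        μ (Prod.mk x ⁻¹' ((fun p : ℝ × ℝ => f p.1 + p.2) ⁻¹' s)) := fun x => by
      rw [Measure.map_apply (by fun_prop) hs]; rfl
    simp_rw [this]
    exact measurable_measure_prodMk_left (hm hs)
  ext s hs
  rw [arStep, Measure.bind_apply hs hk.aemeasurable, Measure.map_apply hm hs,
    Measure.prod_apply (hm hs)]
  refine lintegral_congr fun x => ?_
  rw [Measure.map_apply (by fun_prop) hs]; rfl

/-- the dual operator -/
noncomputable def narP (μ : Measure ℝ) (f : ℝ → ℝ) (φ : ℝ → ℝ) : ℝ → ℝ :=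
  fun x => ∫ e, φ (f x + e) ∂μ

def narG (φ : ℝ → ℝ) : Prop := Measurable φ ∧ ∃ A : ℝ, 0 ≤ A ∧ ∀ x, |φ x| ≤ A * (1 + |x|)

lemma narG_int {φ : ℝ → ℝ} (h : narG φ) (ν : Measure ℝ) [IsProbabilityMeasure ν]
    (hν : Integrable (fun x => |x|) ν) : Integrable φ ν := by
  obtain ⟨hm, A, hA, hb⟩ := h
  exact Integrable.mono' (((integrable_const 1).add hν).const_mul A) hm.aestronglyMeasurable
    (Filter.Eventually.of_forall hb)

lemma narG_int_shift {φ : ℝ → ℝ} (h : narG φ) (ν : Measure ℝ) [IsProbabilityMeasure ν]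
    (hν : Integrable (fun x => |x|) ν) (a : ℝ) : Integrable (fun e => φ (a + e)) ν := by
  refine narG_int (φ := fun e => φ (a + e)) ?_ ν hν
  obtain ⟨hm, A, hA, hb⟩ := h
  refine ⟨by fun_prop, A * (1 + |a|), by positivity, fun e => (hb _).trans ?_⟩
  rw [mul_assoc]
  gcongr
  nlinarith [abs_add_le a e, abs_nonneg a, abs_nonneg e]

lemma narG_P (μ : Measure ℝ) [IsProbabilityMeasure μ] (hμ : Integrable (fun x => |x|) μ)
    (f : ℝ → ℝ) (hf : Measurable f) (l M : ℝ) (hl : 0 ≤ l) (hM : 0 ≤ M)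
    (hfl : ∀ x, |f x| ≤ l * |x| + M) {φ : ℝ → ℝ} (h : narG φ) : narG (narP μ f φ) := by
  have hs := narG_int_shift h μ hμ
  obtain ⟨hm, A, hA, hb⟩ := h
  have hE : 0 ≤ ∫ e, |e| ∂μ := integral_nonneg fun _ => abs_nonneg _
  refine ⟨?_, A * (1 + l + M + ∫ e, |e| ∂μ), by positivity, fun x => ?_⟩
  · have : StronglyMeasurable (fun p : ℝ × ℝ => φ (f p.1 + p.2)) :=
      Measurable.stronglyMeasurable (by fun_prop)
    exact this.integral_prod_right.measurable
  · have h1 : |narP μ f φ x| ≤ ∫ e, A * ((1 + |f x|) + |e|) ∂μ := by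
      refine (abs_integral_le_integral_abs).trans (integral_mono (hs _).abs
        (((integrable_const _).add hμ).const_mul A) fun e => (hb _).trans ?_)
      have := abs_add_le (f x) e
      show _ ≤ A * ((1 + |f x|) + |e|)
      exact mul_le_mul_of_nonneg_left (by linarith) hA
    rw [integral_const_mul, integral_add (integrable_const _) hμ] at h1
    simp only [integral_const, probReal_univ, one_smul] at h1
    refine h1.trans ?_
    rw [mul_assoc]
    gcongr
    nlinarith [hfl x, abs_nonneg x, mul_nonneg hM (abs_nonneg x), mul_nonneg hE (abs_nonneg x)]

lemma nar_step_int (μ : Measure ℝ) [IsProbabilityMeasure μ] (hμ : Integrable (fun x => |x|) μ)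
    (f : ℝ → ℝ) (hf : Measurable f) (l M : ℝ) (hl : 0 ≤ l) (hM : 0 ≤ M)
    (hfl : ∀ x, |f x| ≤ l * |x| + M) (ν : Measure ℝ) [IsProbabilityMeasure ν]
    (hν : Integrable (fun x => |x|) ν) :
    IsProbabilityMeasure (arStep μ f ν) ∧ Integrable (fun x => |x|) (arStep μ f ν) ∧
    ∀ φ, narG φ → ∫ y, φ y ∂(arStep μ f ν) = ∫ x, narP μ f φ x ∂ν := by
  have hm : Measurable fun p : ℝ × ℝ => f p.1 + p.2 := by fun_prop
  have e := nar_step_eq μ f hf ν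
  have hp : IsProbabilityMeasure (arStep μ f ν) := by
    rw [e]; exact Measure.isProbabilityMeasure_map hm.aemeasurable
  have hi : Integrable (fun x => |x|) (arStep μ f ν) := by
    rw [e, integrable_map_measure (by fun_prop) hm.aemeasurable]
    have h1 : Integrable (fun p : ℝ × ℝ => |p.1|) (ν.prod μ) := hν.comp_fst μ
    have h2 : Integrable (fun p : ℝ × ℝ => |p.2|) (ν.prod μ) := hμ.comp_snd ν
    refine Integrable.mono' (((h1.const_mul l).add (integrable_const M)).add h2)
      (by fun_prop) (Filter.Eventually.of_forall fun p => ?_)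
    have := abs_add_le (f p.1) p.2
    have := hfl p.1
    simp only [Function.comp, Real.norm_eq_abs, abs_abs, Pi.add_apply]
    linarith
  refine ⟨hp, hi, fun φ hφ => ?_⟩
  have hφi := narG_int hφ _ hi
  rw [e, integrable_map_measure hφ.1.aestronglyMeasurable hm.aemeasurable] at hφi
  rw [e, integral_map hm.aemeasurable hφ.1.aestronglyMeasurable]
  exact integral_prod _ hφi

lemma nar_iter_int (μ : Measure ℝ) [IsProbabilityMeasure μ] (hμ : Integrable (fun x => |x|) μ)
    (f : ℝ → ℝ) (hf : Measurable f) (l M : ℝ) (hl : 0 ≤ l) (hM : 0 ≤ M)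
    (hfl : ∀ x, |f x| ≤ l * |x| + M) (φ : ℝ → ℝ) (hφ : narG φ) (k : ℕ) :
    narG ((narP μ f)^[k] φ) ∧ ∀ (ν : Measure ℝ) [IsProbabilityMeasure ν],
    Integrable (fun x => |x|) ν →
    ∫ y, φ y ∂((arStep μ f)^[k] ν) = ∫ x, ((narP μ f)^[k] φ) x ∂ν := by
  induction k with
  | zero => exact ⟨hφ, fun _ _ _ => rfl⟩
  | succ k ih =>
    rw [Function.iterate_succ', Function.comp]
    refine ⟨narG_P μ hμ f hf l M hl hM hfl ih.1, fun ν _ hν => ?_⟩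
    obtain ⟨h1, h2, h3⟩ := nar_step_int μ hμ f hf l M hl hM hfl ν hν
    rw [Function.iterate_succ, Function.comp, ih.2 _ h2, h3 _ ih.1]

/-- one-step contraction -/
lemma nar_contract (μ : Measure ℝ) [IsProbabilityMeasure μ]
    (ρ : ℝ → ℝ) (hρmeas : Measurable ρ) (hρpos : ∀ x, 0 < ρ x)
    (hdens : μ = volume.withDensity fun x => ENNReal.ofReal (ρ x))
    (hμ : Integrable (fun x => |x|) μ) (β m : ℝ) (hβ : 0 ≤ β) (hm : 0 ≤ m)
    (φ : ℝ → ℝ) (hφ : narG φ) (hd : ∀ x y, |φ x - φ y| ≤ m * (2 + β * |x| + β * |y|))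
    (a b : ℝ) :
    |(∫ e, φ (a + e) ∂μ) - ∫ e, φ (b + e) ∂μ| ≤
      m * ((∫ u, |ρ u - ρ (u - (b - a))|) + β * (|a| + |b| + 2 * ∫ e, |e| ∂μ)) := by
  obtain ⟨c, hc⟩ : ∃ c, ∀ x, |φ x - c| ≤ m * (1 + β * |x|) := by
    have hbdd : ∀ x, (⨆ y, (φ y - m * (1 + β * |y|))) ≤ φ x + m * (1 + β * |x|) := fun x =>
      ciSup_le fun y => by have := (abs_le.1 (hd y x)).2; linarith
    refine ⟨⨆ y, (φ y - m * (1 + β * |y|)), fun x => abs_le.2 ⟨by linarith [hbdd x], ?_⟩⟩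
    have hB : BddAbove (Set.range fun y => (φ y - m * (1 + β * |y|))) := by
      refine ⟨φ 0 + m * (1 + β * |0|), ?_⟩
      rintro _ ⟨y, rfl⟩
      have := (abs_le.1 (hd y 0)).2
      simp only
      linarith
    have := le_ciSup hB x
    linarith
  have hI : ∀ g : ℝ → ℝ, ∫ e, g e ∂μ = ∫ e, ρ e * g e := fun g => by
    rw [hdens, integral_withDensity_eq_integral_toReal_smul (by fun_prop) (by simp)]
    simp [ENNReal.toReal_ofReal (hρpos _).le]
  have hIi : ∀ g : ℝ → ℝ, Integrable g μ → Integrable (fun e => ρ e * g e) := fun g hg => by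
    rw [hdens, integrable_withDensity_iff_integrable_smul' (by fun_prop) (by simp)] at hg
    simpa [ENNReal.toReal_ofReal (hρpos _).le] using hg
  -- shifted versions
  have hS : ∀ (g : ℝ → ℝ) (t : ℝ), ∫ e, g (t + e) ∂μ = ∫ u, ρ (u - t) * g u := fun g t => by
    rw [hI, ← integral_sub_right_eq_self _ t]
    simp
  have hSi : ∀ (g : ℝ → ℝ) (t : ℝ), Integrable (fun e => g (t + e)) μ →
      Integrable (fun u => ρ (u - t) * g u) := fun g t h => by
    have := (hIi _ h).comp_sub_right t
    simpa using this
  have hab : narG fun x => |x| := ⟨by fun_prop, 1, by norm_num, fun x => by simp⟩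
  have hφc : narG fun x => φ x - c := by
    refine ⟨hφ.1.sub_const c, m * (1 + β), by positivity, fun x => (hc x).trans ?_⟩
    rw [mul_assoc]; gcongr
    nlinarith [abs_nonneg x]
  have iφ := fun t => hSi (fun x => φ x - c) t (narG_int_shift hφc μ hμ t)
  have iV := fun t => hSi (fun x => |x|) t (narG_int_shift hab μ hμ t)
  have i1 : ∀ t, Integrable fun u => ρ (u - t) := fun t => by
    simpa using hSi (fun _ => 1) t (integrable_const _)
  have eφ : ∀ t, ∫ e, φ (t + e) ∂μ = (∫ u, ρ (u - t) * (φ u - c)) + c := fun t => by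
    rw [← hS (fun u => φ u - c), integral_sub (narG_int_shift hφ μ hμ t) (integrable_const _)]
    simp
  have eV : ∀ t, ∫ u, ρ (u - t) * |u| ≤ |t| + ∫ e, |e| ∂μ := fun t => by
    rw [← hS (fun u => |u|)]
    refine (integral_mono (narG_int_shift hab μ hμ t) ((integrable_const |t|).add hμ)
      fun e => abs_add_le t e).trans ?_
    simp only [Pi.add_apply]
    rw [integral_add (integrable_const _) hμ]
    simp
  have eT : ∫ u, |ρ u - ρ (u - (b - a))| = ∫ u, |ρ (u - a) - ρ (u - b)| := by
    rw [← integral_sub_right_eq_self _ a]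
    congr 1; ext u; congr 3; ring
  have iT : Integrable fun u => |ρ (u - a) - ρ (u - b)| := ((i1 a).sub (i1 b)).abs
  rw [eφ, eφ, add_sub_add_right_eq_sub, ← integral_sub (iφ a) (iφ b), eT]
  calc _ ≤ ∫ u, m * (|ρ (u - a) - ρ (u - b)| + β * (ρ (u - a) * |u| + ρ (u - b) * |u|)) := by
        refine (abs_integral_le_integral_abs).trans (integral_mono ((iφ a).sub (iφ b)).abs
          ((iT.add (((iV a).add (iV b)).const_mul β)).const_mul m) fun u => ?_)
        show |ρ (u - a) * (φ u - c) - ρ (u - b) * (φ u - c)| ≤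
          m * (|ρ (u - a) - ρ (u - b)| + β * (ρ (u - a) * |u| + ρ (u - b) * |u|))
        rw [← sub_mul, abs_mul]
        have h1 : |ρ (u - a) - ρ (u - b)| ≤ ρ (u - a) + ρ (u - b) := by
          have := hρpos (u - a); have := hρpos (u - b)
          rw [abs_le]; constructor <;> linarith
        calc _ ≤ |ρ (u - a) - ρ (u - b)| * (m * (1 + β * |u|)) := by gcongr; exact hc u
          _ = m * (|ρ (u - a) - ρ (u - b)| + β * (|ρ (u - a) - ρ (u - b)| * |u|)) := by ring
          _ ≤ m * (|ρ (u - a) - ρ (u - b)| + β * ((ρ (u - a) + ρ (u - b)) * |u|)) := by gcongr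
          _ = _ := by ring
    _ = m * ((∫ u, |ρ (u - a) - ρ (u - b)|) +
          β * ((∫ u, ρ (u - a) * |u|) + ∫ u, ρ (u - b) * |u|)) := by
        have j : Integrable fun u => β * (ρ (u - a) * |u| + ρ (u - b) * |u|) :=
          ((iV a).add (iV b)).const_mul β
        rw [integral_const_mul, integral_add iT j, integral_const_mul,
          integral_add (iV a) (iV b)]
    _ ≤ _ := by
        have := eV a; have := eV b
        exact mul_le_mul_of_nonneg_left (add_le_add le_rfl
          (mul_le_mul_of_nonneg_left (by linarith) hβ)) hm

/-- For the scalar nonlinear autoregression `X (t+1) = f (X t) + ε t`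
(i.i.d. noise with integrable, everywhere-positive density; `f` measurable, bounded
on compact sets, with `sup_{|x| > r} |f x / x| < 1` for some `r > 0`), started from
its unique stationary distribution `π`, if moreover `E |X t| ^ (2 + δ) < ∞` for some
`δ > 0`, then the stationary process has exponentially decaying autocovariance
`γ_X(k) = Cov (X 0, X k) = E[X 0 * X k] - (E[X 0])²`: there are `C < ∞` and
`s ∈ (0,1)` with `|γ_X(k)| ≤ C s ^ k` for all `k ≥ 0`; in particular the process
has short memory. -/
theorem nonlinear_ar_short_memory
    (μ : Measure ℝ) [IsProbabilityMeasure μ]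
    (ρ : ℝ → ℝ) (hρmeas : Measurable ρ) (hρpos : ∀ x, 0 < ρ x)
    (hdens : μ = volume.withDensity fun x => ENNReal.ofReal (ρ x))
    (hmoment : Integrable (fun x => |x|) μ)
    (f : ℝ → ℝ) (hf : Measurable f)
    (hfbdd : ∀ K : Set ℝ, IsCompact K → ∃ M : ℝ, ∀ x ∈ K, |f x| ≤ M)
    (hcontract : ∃ r : ℝ, 0 < r ∧ ∃ c : ℝ, c < 1 ∧ ∀ x : ℝ, r < |x| → |f x / x| ≤ c)
    -- `π` is the stationary distribution of the chain
    (π : Measure ℝ) (hπprob : IsProbabilityMeasure π) (hπstat : arStep μ f π = π)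
    -- `E |X t| ^ (2 + δ) < ∞` for some `δ > 0`
    (hmom2 : ∃ δ : ℝ, 0 < δ ∧ ∫⁻ x, ENNReal.ofReal (|x| ^ ((2 : ℝ) + δ)) ∂π < ⊤)
    -- `γ k = Cov (X 0, X k)`, computed from `π` and the `k`-step kernel:
    -- `E[X 0 * X k] = ∫ x * E[X k | X 0 = x] dπ(x)`
    (γ : ℕ → ℝ)
    (hγ : ∀ k : ℕ, γ k =
      (∫ x, x * (∫ y, y ∂((arStep μ f)^[k] (Measure.dirac x))) ∂π)
        - (∫ x, x ∂π) ^ 2) :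
    ∃ (C : ℝ) (s : ℝ), s ∈ Set.Ioo (0 : ℝ) 1 ∧
      (∀ k : ℕ, |γ k| ≤ C * s ^ k) ∧ Summable (fun k : ℕ => |γ k|) := by
  obtain ⟨r, hr, c, hc1, hc⟩ := hcontract
  obtain ⟨δ, hδ, hmom⟩ := hmom2
  -- linear growth of f
  obtain ⟨l, M, hl0, hl1, hM, hfl⟩ : ∃ l M : ℝ, 0 ≤ l ∧ l < 1 ∧ 0 ≤ M ∧
      ∀ x, |f x| ≤ l * |x| + M := by
    obtain ⟨M, hM⟩ := hfbdd _ (isCompact_Icc (a := -r) (b := r))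
    refine ⟨max c 0, max M 0, le_max_right _ _, max_lt hc1 one_pos, le_max_right _ _, fun x => ?_⟩
    by_cases hx : r < |x|
    · have h1 := hc x hx
      have hx0 : 0 < |x| := hr.trans hx
      rw [abs_div, div_le_iff₀ hx0] at h1
      have : c * |x| ≤ max c 0 * |x| := by gcongr; exact le_max_left _ _
      have := le_max_right M 0
      linarith
    · have h1 := hM x (abs_le.1 (not_lt.1 hx))
      have : 0 ≤ max c 0 * |x| := mul_nonneg (le_max_right _ _) (abs_nonneg _)
      have := le_max_left M 0
      linarith
  have hρi : Integrable ρ := by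
    have := (integrable_const (1 : ℝ) : Integrable (fun _ : ℝ => (1 : ℝ)) μ)
    rw [hdens, integrable_withDensity_iff_integrable_smul' (by fun_prop) (by simp)] at this
    simpa [ENNReal.toReal_ofReal (hρpos _).le] using this
  have hρ1 : ∫ x, ρ x = 1 := by
    have : ∫ _, (1 : ℝ) ∂μ = 1 := by simp
    rw [hdens, integral_withDensity_eq_integral_toReal_smul (by fun_prop) (by simp)] at this
    simpa [ENNReal.toReal_ofReal (hρpos _).le] using this
  have hE : 0 ≤ ∫ e, |e| ∂μ := integral_nonneg fun _ => abs_nonneg _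
  obtain ⟨K, hK⟩ : ∃ K, K = M + (∫ e, |e| ∂μ) + 1 := ⟨_, rfl⟩
  have hKpos : 0 < K := by rw [hK]; positivity
  obtain ⟨R, hR⟩ : ∃ R, R = 8 * K / (1 - l) := ⟨_, rfl⟩
  have hRl : R * (1 - l) = 8 * K := by
    rw [hR]; field_simp [(sub_pos.2 hl1).ne']
  obtain ⟨α, hα, htv⟩ := nar_tv ρ hρpos hρi hρ1 (l * R + 2 * M)
  have htv2 : ∀ z, ∫ u, |ρ u - ρ (u - z)| ≤ 2 := fun z => by
    obtain ⟨α', h1, h2⟩ := nar_tv ρ hρpos hρi hρ1 |z|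
    linarith [h2 z le_rfl]
  obtain ⟨β, hβdef⟩ : ∃ β, β = α / (2 * K) := ⟨_, rfl⟩
  have hβ : 0 < β := by rw [hβdef]; positivity
  have hβK : 2 * (β * K) = α := by rw [hβdef]; field_simp
  obtain ⟨s, hs⟩ : ∃ s, s = max (1 - α / 2) ((1 + l) / 2) := ⟨_, rfl⟩
  have hs1 : s < 1 := by rw [hs]; exact max_lt (by linarith) (by linarith)
  have hsα : 1 - α / 2 ≤ s := hs ▸ le_max_left _ _
  have hsl : (1 + l) / 2 ≤ s := hs ▸ le_max_right _ _
  have hs0 : 0 < s := by linarith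
  have hcontr : ∀ (φ : ℝ → ℝ) (m : ℝ), 0 ≤ m → narG φ →
      (∀ x y, |φ x - φ y| ≤ m * (2 + β * |x| + β * |y|)) →
      ∀ x y, |narP μ f φ x - narP μ f φ y| ≤ (m * s) * (2 + β * |x| + β * |y|) := by
    intro φ m hm hφ hd x y
    refine (nar_contract μ ρ hρmeas hρpos hdens hmoment β m hβ.le hm φ hφ hd (f x) (f y)).trans ?_
    rw [mul_assoc]
    refine mul_le_mul_of_nonneg_left ?_ hm
    have hx := hfl x
    have hy := hfl y
    have hS : 0 ≤ |x| + |y| := by positivity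
    have h1 : β * (|f x| + |f y| + 2 * ∫ e, |e| ∂μ) ≤ β * (l * (|x| + |y|)) + α := by
      have : |f x| + |f y| + 2 * ∫ e, |e| ∂μ ≤ l * (|x| + |y|) + 2 * K := by rw [hK]; linarith
      have := mul_le_mul_of_nonneg_left this hβ.le
      linarith
    by_cases hSR : |x| + |y| ≤ R
    · have h2 := htv (f y - f x) (by
        have : |f y - f x| ≤ |f y| + |f x| := abs_sub _ _
        have : l * (|x| + |y|) ≤ l * R := by gcongr
        linarith)
      have h3 : β * (l * (|x| + |y|)) ≤ β * (s * (|x| + |y|)) := by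
        gcongr; linarith
      linarith
    · have h2 := htv2 (f y - f x)
      have h3 : β * (((1 + l) / 2 - l) * R) ≤ β * ((s - l) * (|x| + |y|)) := by
        have : 0 ≤ s - l := by linarith
        have : 0 ≤ (1 + l) / 2 - l := by linarith
        have := not_le.1 hSR
        gcongr
        · rw [hR]; have := sub_pos.2 hl1; positivity
      have h4 : ((1 + l) / 2 - l) * R = 4 * K := by linarith
      rw [h4] at h3
      linarith
  have hid : narG fun x => x := ⟨measurable_id, 1, by norm_num, fun x => by simp⟩
  have hiter := nar_iter_int μ hmoment f hf l M hl0 hM hfl (fun x => x) hid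
  obtain ⟨Q, hQ⟩ : ∃ Q : ℕ → ℝ → ℝ, ∀ k, Q k = (narP μ f)^[k] (fun x => x) := ⟨_, fun _ => rfl⟩
  have hQG : ∀ k, narG (Q k) := fun k => hQ k ▸ (hiter k).1
  have hQd : ∀ k x y, |Q k x - Q k y| ≤ (β⁻¹ * s ^ k) * (2 + β * |x| + β * |y|) := by
    intro k
    induction k with
    | zero =>
      intro x y
      rw [hQ]
      have h1 : |x - y| ≤ |x| + |y| := abs_sub _ _
      have h2 : β⁻¹ * (2 + β * |x| + β * |y|) = 2 * β⁻¹ + (|x| + |y|) := by field_simp; ring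
      have : 0 < β⁻¹ := by positivity
      simp only [Function.iterate_zero, id, pow_zero, mul_one]
      linarith
    | succ k ih =>
      have e : Q (k + 1) = narP μ f (Q k) := by
        rw [hQ, hQ, Function.iterate_succ', Function.comp]
      rw [e, pow_succ, ← mul_assoc]
      exact hcontr (Q k) _ (by positivity) (hQG k) ih
  -- moments of π
  have hπ2 : Integrable (fun x : ℝ => x ^ 2) π := by
    have h : Integrable (fun x : ℝ => |x| ^ ((2 : ℝ) + δ)) π := by
      refine ⟨(Measurable.pow_const (by fun_prop) _).aestronglyMeasurable, ?_⟩
      rw [hasFiniteIntegral_iff_ofReal (Filter.Eventually.of_forall fun x => by positivity)]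
      exact hmom
    refine Integrable.mono' ((integrable_const 1).add h) (by fun_prop)
      (Filter.Eventually.of_forall fun x => ?_)
    simp only [Real.norm_eq_abs, Pi.add_apply]
    rw [abs_of_nonneg (sq_nonneg x), ← sq_abs]
    rcases le_total |x| 1 with hx | hx
    · have : |x| ^ 2 ≤ 1 := pow_le_one₀ (abs_nonneg _) hx
      have : 0 ≤ |x| ^ ((2 : ℝ) + δ) := by positivity
      linarith
    · have : |x| ^ (2 : ℝ) ≤ |x| ^ ((2 : ℝ) + δ) :=
        Real.rpow_le_rpow_of_exponent_le hx (by linarith)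
      rw [Real.rpow_two] at this
      linarith
  have hπ1 : Integrable (fun x : ℝ => |x|) π := by
    refine Integrable.mono' ((integrable_const 1).add hπ2) (by fun_prop)
      (Filter.Eventually.of_forall fun x => ?_)
    simp only [Real.norm_eq_abs, Pi.add_apply, abs_abs]
    nlinarith [sq_nonneg (|x| - 1), sq_abs x]
  have hQπ : ∀ k, ∫ x, Q k x ∂π = ∫ x, x ∂π := fun k => by
    have h := (hiter k).2 π hπ1
    rw [Function.iterate_fixed hπstat] at h
    rw [h, hQ]
  have hQx : ∀ k x, ∫ y, y ∂((arStep μ f)^[k] (Measure.dirac x)) = Q k x := fun k x => by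
    have h := (hiter k).2 (Measure.dirac x) (integrable_dirac (by simp))
    rw [h, hQ, integral_dirac]
  obtain ⟨E, hEdef⟩ : ∃ E, E = ∫ x, |x| ∂π := ⟨_, rfl⟩
  have hQm : ∀ k x, |Q k x - ∫ y, y ∂π| ≤ (β⁻¹ * s ^ k) * (2 + β * |x| + β * E) := by
    intro k x
    have hi := narG_int (hQG k) π hπ1
    have e1 : Q k x - ∫ y, y ∂π = ∫ y, (Q k x - Q k y) ∂π := by
      rw [integral_sub (integrable_const _) hi, hQπ]; simp
    rw [e1]
    refine abs_integral_le_integral_abs.trans ((integral_mono ((integrable_const _).sub hi).abs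
      (((integrable_const (2 + β * |x|)).add (hπ1.const_mul β)).const_mul (β⁻¹ * s ^ k))
      fun y => hQd k x y).trans ?_)
    simp only [Pi.add_apply]
    rw [integral_const_mul, integral_add (integrable_const _) (hπ1.const_mul β),
      integral_const_mul, ← hEdef]
    simp
  have hbd : Integrable (fun x : ℝ => (2 + β * E) * |x| + β * x ^ 2) π :=
    (hπ1.const_mul _).add (hπ2.const_mul _)
  have hxi : Integrable (fun x : ℝ => x) π := narG_int hid π hπ1
  have hmain : ∀ k, |γ k| ≤ (β⁻¹ * ∫ x, ((2 + β * E) * |x| + β * x ^ 2) ∂π) * s ^ k := by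
    intro k
    have hpt : ∀ x, |x * (Q k x - ∫ y, y ∂π)| ≤
        (β⁻¹ * s ^ k) * ((2 + β * E) * |x| + β * x ^ 2) := fun x => by
      rw [abs_mul]
      calc _ ≤ |x| * ((β⁻¹ * s ^ k) * (2 + β * |x| + β * E)) := by gcongr; exact hQm k x
        _ = _ := by rw [← sq_abs x]; ring
    have hi : Integrable (fun x => x * (Q k x - ∫ y, y ∂π)) π :=
      Integrable.mono' (hbd.const_mul (β⁻¹ * s ^ k))
        (measurable_id.mul ((hQG k).1.sub_const _)).aestronglyMeasurable
        (Filter.Eventually.of_forall hpt)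
    have e : γ k = ∫ x, x * (Q k x - ∫ y, y ∂π) ∂π := by
      rw [hγ]
      simp_rw [hQx]
      have e2 : ∀ x, x * Q k x = x * (Q k x - ∫ y, y ∂π) + x * ∫ y, y ∂π := fun x => by ring
      simp_rw [e2]
      rw [integral_add hi (hxi.mul_const _), integral_mul_const]
      ring
    rw [e]
    refine abs_integral_le_integral_abs.trans ((integral_mono hi.abs
      (hbd.const_mul (β⁻¹ * s ^ k)) hpt).trans ?_)
    rw [integral_const_mul]
    exact le_of_eq (by ring)
  refine ⟨_, s, ⟨hs0, hs1⟩, hmain, ?_⟩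
  exact Summable.of_nonneg_of_le (fun _ => abs_nonneg _) hmain
    ((summable_geometric_of_lt_one hs0.le hs1).mul_left _)
end
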